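/- arXiv:0704.2492 — 2 statements merged into one kernel-verified Lean document; each statement's English description precedes it below -/
import Mathlib

section
/- Lemma 3, parts 1 and 2 (normalization and L¹ bound for the additive multi-index kernel). Let g : ℝ → ℝ be integrable with support contained in [−1/2,1/2] and ∫ g(x)dx = 1. Let I = (I₁,…,I_k) be a partition of {1,…,d} into nonempty sets, E an invertible real d×d matrix, and h ∈ (0,∞)^d. Then the kernel K_{(I,E,h)} satisfies ∫_{ℝ^d} K_{(I,E,h)}(t) dt = 1 and ‖K_{(I,E,h)}‖_{L¹(ℝ^d)} ≤ (2k − 1) ‖g‖₁^d. -/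
open MeasureTheory

noncomputable section

/-- `G₀(t) = ∏_{i=1}^d g(t_i)`. -/
def G0 {d : ℕ} (g : ℝ → ℝ) (t : Fin d → ℝ) : ℝ := ∏ i, g (t i)

/-- `G_{i,h}(t) = ∏_{j∈I_i} h_j⁻¹ g(t_j/h_j) · ∏_{j∉I_i} g(t_j)` for a block `I` of the
partition. -/
def Gblock {d : ℕ} (g : ℝ → ℝ) (I : Finset (Fin d)) (h : Fin d → ℝ) (t : Fin d → ℝ) : ℝ :=
  (∏ j ∈ I, (h j)⁻¹ * g (t j / h j)) * ∏ j ∈ Iᶜ, g (t j)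

/-- The additive multi-index kernel
`K_{(I,E,h)}(t) = |det E| [ Σ_{i=1}^k G_{i,h}(Eᵀt) − (k−1) G₀(Eᵀt) ]`. -/
def addKernel {d k : ℕ} (g : ℝ → ℝ) (I : Fin k → Finset (Fin d))
    (E : Matrix (Fin d) (Fin d) ℝ) (h : Fin d → ℝ) (t : Fin d → ℝ) : ℝ :=
  |E.det| *
    ((∑ i, Gblock g (I i) h (E.transpose.mulVec t)) - ((k : ℝ) - 1) * G0 g (E.transpose.mulVec t))

/-- `I` is a partition of `{1,…,d}` into `k` nonempty sets. -/
def IsPartition {d k : ℕ} (I : Fin k → Finset (Fin d)) : Prop :=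
  (∀ i, (I i).Nonempty) ∧ (∀ i j, i ≠ j → Disjoint (I i) (I j)) ∧
    Finset.univ.biUnion I = Finset.univ

/-- The one-dimensional factors of `Gblock`. -/
def blockFactor {d : ℕ} (g : ℝ → ℝ) (I : Finset (Fin d)) (h : Fin d → ℝ) (j : Fin d) (x : ℝ) : ℝ :=
  if j ∈ I then (h j)⁻¹ * g (x / h j) else g x

theorem Gblock_eq_prod {d : ℕ} (g : ℝ → ℝ) (I : Finset (Fin d)) (h : Fin d → ℝ) (t : Fin d → ℝ) :
    Gblock g I h t = ∏ j, blockFactor g I h j (t j) := by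
  rw [Gblock, ← Finset.prod_mul_prod_compl I]
  congr 1
  · exact Finset.prod_congr rfl fun j hj => by simp [blockFactor, hj]
  · exact Finset.prod_congr rfl fun j hj => by simp [blockFactor, Finset.mem_compl.1 hj]

theorem G0_eq_Gblock_empty {d : ℕ} (g : ℝ → ℝ) (h : Fin d → ℝ) (t : Fin d → ℝ) :
    G0 g t = Gblock g ∅ h t := by
  simp [G0, Gblock]

theorem abs_Gblock {d : ℕ} (g : ℝ → ℝ) (I : Finset (Fin d)) {h : Fin d → ℝ} (hh : ∀ j, 0 < h j)
    (t : Fin d → ℝ) : |Gblock g I h t| = Gblock (fun x => |g x|) I h t := by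
  simp only [Gblock, abs_mul, Finset.abs_prod, abs_inv, abs_of_pos (hh _)]

theorem integrable_Gblock {d : ℕ} {g : ℝ → ℝ} (hg : Integrable g) (I : Finset (Fin d))
    {h : Fin d → ℝ} (hh : ∀ j, 0 < h j) : Integrable (Gblock g I h) := by
  rw [funext (Gblock_eq_prod g I h)]
  refine Integrable.fintype_prod fun j => ?_
  unfold blockFactor
  by_cases hj : j ∈ I
  · simpa only [hj, if_true] using (hg.comp_div (hh j).ne').const_mul (h j)⁻¹
  · simpa only [hj, if_false] using hg

theorem integral_Gblock {d : ℕ} (g : ℝ → ℝ) (I : Finset (Fin d))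
    {h : Fin d → ℝ} (hh : ∀ j, 0 < h j) : ∫ t, Gblock g I h t = (∫ x, g x) ^ d := by
  have hfactor (j : Fin d) : ∫ x, blockFactor g I h j x = ∫ x, g x := by
    by_cases hj : j ∈ I
    · simp only [blockFactor, hj, if_true]
      rw [integral_const_mul, Measure.integral_comp_div, abs_of_pos (hh j), smul_eq_mul,
        inv_mul_cancel_left₀ (hh j).ne']
    · simp only [blockFactor, hj, if_false]
  simp_rw [Gblock_eq_prod]
  rw [integral_fintype_prod_volume_eq_prod]
  simp [hfactor]

theorem integral_comp_transpose_mulVec {ι : Type*} [Fintype ι] [DecidableEq ι]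
    {E : Matrix ι ι ℝ} (hE : E.det ≠ 0) (F : (ι → ℝ) → ℝ) :
    |E.det| * ∫ t, F (E.transpose.mulVec t) = ∫ s, F s := by
  have hdet : E.transpose.det ≠ 0 := by rwa [Matrix.det_transpose]
  let e : (ι → ℝ) ≃L[ℝ] (ι → ℝ) :=
    (Matrix.toLin' E.transpose).equivOfDetNeZero (by rwa [LinearMap.det_toLin'])
      |>.toContinuousLinearEquiv
  have hmap := e.toHomeomorph.measurableEmbedding.integral_map (μ := volume) F
  have he : ⇑e.toHomeomorph = ⇑(Matrix.toLin' E.transpose) := rfl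
  rw [he, Real.map_matrix_volume_pi_eq_smul_volume_pi hdet, integral_smul_measure,
    ENNReal.toReal_ofReal (abs_nonneg _), Matrix.det_transpose, abs_inv, smul_eq_mul] at hmap
  simp only [Matrix.toLin'_apply] at hmap
  rw [← hmap, mul_inv_cancel_left₀ (abs_ne_zero.2 hE)]

/-- **Lemma 3, parts 1 and 2.** The additive multi-index kernel integrates to one and its
`L¹` norm is at most `(2k−1)‖g‖₁^d`. -/
theorem addKernel_normalization_and_L1
    (d k : ℕ) (hd : 1 ≤ d)
    (g : ℝ → ℝ) (hg_int : Integrable g)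
    (hg_supp : Function.support g ⊆ Set.Icc (-(1/2) : ℝ) (1/2))
    (hg_one : (∫ x, g x) = 1)
    (I : Fin k → Finset (Fin d)) (hI : IsPartition I)
    (E : Matrix (Fin d) (Fin d) ℝ) (hE : E.det ≠ 0)
    (h : Fin d → ℝ) (hh : ∀ j, 0 < h j) :
    (∫ t, addKernel g I E h t) = 1 ∧
    (∫ t, |addKernel g I E h t|) ≤ (2 * (k : ℝ) - 1) * (∫ x, |g x|) ^ d := by
  have hk : 1 ≤ k := by
    have hmem : (⟨0, hd⟩ : Fin d) ∈ Finset.univ.biUnion I := hI.2.2 ▸ Finset.mem_univ _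
    obtain ⟨i, -, -⟩ := Finset.mem_biUnion.1 hmem
    exact i.pos
  have hk' : (0 : ℝ) ≤ k - 1 := sub_nonneg.2 (mod_cast hk)
  let Φ : (Fin d → ℝ) → ℝ := fun s => (∑ i, Gblock g (I i) h s) - ((k : ℝ) - 1) * Gblock g ∅ h s
  have hK (t : Fin d → ℝ) : addKernel g I E h t = |E.det| * Φ (E.transpose.mulVec t) := by
    rw [addKernel, G0_eq_Gblock_empty g h]
  have hint (J : Finset (Fin d)) : Integrable (Gblock g J h) := integrable_Gblock hg_int J hh
  have hsum : Integrable fun s => ∑ i, Gblock g (I i) h s :=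
    integrable_finsetSum _ fun i _ => hint (I i)
  have hempty : Integrable fun s => ((k : ℝ) - 1) * Gblock g ∅ h s := (hint ∅).const_mul _
  constructor
  · simp_rw [hK]
    rw [integral_const_mul, integral_comp_transpose_mulVec hE, integral_sub hsum hempty,
      integral_finsetSum _ fun i _ => hint (I i), integral_const_mul]
    simp [integral_Gblock g _ hh, hg_one]
  · have hL1 (J : Finset (Fin d)) : ∫ s, |Gblock g J h s| = (∫ x, |g x|) ^ d := by
      simp_rw [abs_Gblock g J hh]
      exact integral_Gblock _ J hh
    have hsum' : Integrable fun s => ∑ i, |Gblock g (I i) h s| :=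
      integrable_finsetSum _ fun i _ => (hint (I i)).abs
    have hempty' : Integrable fun s => ((k : ℝ) - 1) * |Gblock g ∅ h s| :=
      (hint ∅).abs.const_mul _
    simp_rw [hK, abs_mul, abs_abs]
    rw [integral_const_mul, integral_comp_transpose_mulVec hE fun s => |Φ s|]
    calc ∫ s, |Φ s|
        ≤ ∫ s, (∑ i, |Gblock g (I i) h s|) + ((k : ℝ) - 1) * |Gblock g ∅ h s| := by
          refine integral_mono (hsum.sub hempty).abs (hsum'.add hempty') fun s => ?_
          refine (abs_sub _ _).trans (add_le_add (Finset.abs_sum_le_sum_abs _ _) ?_)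
          rw [abs_mul, abs_of_nonneg hk']
      _ = (2 * (k : ℝ) - 1) * (∫ x, |g x|) ^ d := by
          rw [integral_add hsum' hempty', integral_finsetSum _ fun i _ => (hint (I i)).abs,
            integral_const_mul]
          simp only [hL1, Finset.sum_const, Finset.card_univ, Fintype.card_fin, nsmul_eq_mul]
          ring

end
end

section
/- Lemma 4 (bias bound in the additive multi-index model, with explicit dimension-dependent constant). Let g : ℝ → ℝ be integrable with support in [−1/2,1/2], ∫ g(x)dx = 1, and ∫ g(x)x^r dx = 0 for r = 1,…,ℓ. Let I = (I₁,…,I_k) be a partition of {1,…,d}, let E be an invertible real d×d matrix with columns e₁,…,e_d, and write E_i for the d×|I_i| submatrix of columns indexed by I_i. Let h ∈ (0,∞)^d and suppose F(t) = Σ_{i=1}^k f_i(E_iᵀ t), where f_i ∈ ℍ_{|I_i|}(β_i, L) with β_i = l_i + α_i, l_i a nonnegative integer, α_i ∈ (0,1], and l_i ≤ ℓ for each i. Then for every x ∈ ℝ^d, | ∫_{ℝ^d} K_{(I,E,h)}(t − x) F(t) dt − F(x) | ≤ L Σ_{i=1}^k |I_i|^{β_i/2} ‖g‖₁^{|I_i|}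 Σ_{j∈I_i} h_j^{β_i}. -/
open MeasureTheory

noncomputable section

/-- The partial derivative of `f : (ι → ℝ) → ℝ` in coordinate direction `i`. -/
def pderiv' {ι : Type*} [Fintype ι] [DecidableEq ι] (i : ι)
    (f : (ι → ℝ) → ℝ) : (ι → ℝ) → ℝ :=
  fun x => fderiv ℝ f x (Pi.single i 1)

/-- The multi-index partial derivative `D^𝐤 f` of `f : (ι → ℝ) → ℝ`. -/
def mderiv {ι : Type*} [Fintype ι] [DecidableEq ι] (κ : ι → ℕ)
    (f : (ι → ℝ) → ℝ) : (ι → ℝ) → ℝ :=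
  (Finset.univ : Finset ι).toList.foldr (fun i F => (pderiv' i)^[κ i] F) f

/-- The Taylor polynomial `Σ_{j=0}^l (1/j!) Σ_{|𝐤|=j} D^𝐤 f(t) (z−t)^𝐤` of `f` around `t`. -/
def taylorPoly {ι : Type*} [Fintype ι] [DecidableEq ι] (l : ℕ)
    (f : (ι → ℝ) → ℝ) (t z : ι → ℝ) : ℝ :=
  ∑ j ∈ Finset.range (l + 1), ((j.factorial : ℝ))⁻¹ *
    ∑ κ ∈ (Finset.univ : Finset (ι → Fin (j + 1))).filter (fun κ => ∑ i, (κ i : ℕ) = j),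
      mderiv (fun i => (κ i : ℕ)) f t * ∏ i, (z i - t i) ^ (κ i : ℕ)

/-- The isotropic Hölder ball `ℍ_s(β, L)` with `β = l + α`, `l ∈ ℕ`, `α ∈ (0,1]`:
continuous partial derivatives of all orders `≤ l`, bounded by `L`, and a Taylor remainder
bounded by `L|z−t|^β` (Euclidean norm). -/
def HolderBall {ι : Type*} [Fintype ι] [DecidableEq ι] (l : ℕ) (α L : ℝ)
    (f : (ι → ℝ) → ℝ) : Prop :=
  ContDiff ℝ l f ∧
  (∀ κ : ι → ℕ, (∑ i, κ i) ≤ l → ∀ t, |mderiv κ f t| ≤ L) ∧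
  (∀ z t, |f z - taylorPoly l f t z|
      ≤ L * Real.sqrt (∑ i, (z i - t i) ^ 2) ^ ((l : ℝ) + α))

/-- The rescaling `u ↦ c⁻¹ g(u/c)` of a one-dimensional kernel. -/
def rescale (g : ℝ → ℝ) (c : ℝ) (u : ℝ) : ℝ := c⁻¹ * g (u / c)

lemma integrable_rescale {g : ℝ → ℝ} (hg : Integrable g) {c : ℝ} (hc : c ≠ 0) :
    Integrable (rescale g c) :=
  (hg.comp_div hc).const_mul _

lemma integral_rescale_mul_pow (g : ℝ → ℝ) {c : ℝ} (hc : 0 < c) (r : ℕ) :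
    ∫ u, rescale g c u * u ^ r = c ^ r * ∫ x, g x * x ^ r := by
  have key : ∀ u, rescale g c u * u ^ r = (c⁻¹ * c ^ r) * (g (u / c) * (u / c) ^ r) := by
    intro u
    rw [rescale, div_pow]
    field_simp
  simp_rw [key]
  rw [integral_const_mul, Measure.integral_comp_div (fun x => g x * x ^ r) c, abs_of_pos hc,
    smul_eq_mul]
  field_simp

lemma integral_rescale (g : ℝ → ℝ) {c : ℝ} (hc : 0 < c) :
    ∫ u, rescale g c u = ∫ x, g x := by
  simpa using integral_rescale_mul_pow g hc 0

lemma integral_abs_rescale (g : ℝ → ℝ) {c : ℝ} (hc : 0 < c) :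
    ∫ u, |rescale g c u| = ∫ x, |g x| := by
  rw [← integral_rescale (fun x => |g x|) hc]
  simp only [rescale, abs_mul, abs_of_pos (inv_pos.2 hc)]

lemma abs_le_of_rescale_ne_zero {g : ℝ → ℝ}
    (hg : Function.support g ⊆ Set.Icc (-(1/2) : ℝ) (1/2)) {c : ℝ} (hc : 0 < c) {u : ℝ}
    (hu : rescale g c u ≠ 0) : |u| ≤ c := by
  have h1 := hg (Function.mem_support.2 (right_ne_zero_of_mul hu))
  have h2 : |u / c| ≤ 1 := abs_le.2 ⟨by linarith [h1.1], by linarith [h1.2]⟩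
  rwa [abs_div, abs_of_pos hc, div_le_one hc] at h2

lemma integrable_mul_pow {a : ℝ → ℝ} (ha : Integrable a) {c : ℝ}
    (hs : ∀ x, a x ≠ 0 → |x| ≤ c) (r : ℕ) : Integrable (fun x => a x * x ^ r) := by
  refine (ha.norm.mul_const (c ^ r)).mono'
    (ha.aestronglyMeasurable.mul (by fun_prop)) (Filter.Eventually.of_forall fun x => ?_)
  by_cases hx : a x = 0
  · simp [hx]
  · rw [norm_mul, norm_pow]
    gcongr
    exact hs x hx

lemma mderiv_zero {ι : Type*} [Fintype ι] [DecidableEq ι] {κ : ι → ℕ} (hκ : ∀ i, κ i = 0)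
    (f : (ι → ℝ) → ℝ) : mderiv κ f = f := by
  simp [mderiv, hκ]

lemma HolderBall.abs_le {ι : Type*} [Fintype ι] [DecidableEq ι] {l : ℕ} {α L : ℝ}
    {f : (ι → ℝ) → ℝ} (hf : HolderBall l α L f) (t : ι → ℝ) : |f t| ≤ L := by
  have := hf.2.1 (fun _ => 0) (by simp) t
  rwa [mderiv_zero (fun _ => rfl)] at this

/-- The product kernel `∏ aᵢ(uᵢ)` has the moments of a Dirac mass up to order `ℓ`. -/
lemma integral_prod_mul_prod_pow {ι : Type*} [Fintype ι] {a : ι → ℝ → ℝ} {ℓ : ℕ}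
    (h_one : ∀ i, ∫ x, a i x = 1)
    (h_mom : ∀ i, ∀ r : ℕ, 1 ≤ r → r ≤ ℓ → ∫ x, a i x * x ^ r = 0)
    {j : ℕ} (hj : j ≤ ℓ) {κ : ι → ℕ} (hκ : ∑ i, κ i = j) :
    ∫ u : ι → ℝ, (∏ i, a i (u i)) * ∏ i, u i ^ κ i = if j = 0 then 1 else 0 := by
  simp_rw [← Finset.prod_mul_distrib]
  rw [integral_fintype_prod_volume_eq_prod (fun i x => a i x * x ^ κ i)]
  split_ifs with hj0
  · have h0 : ∀ i, κ i = 0 := by simpa [hj0] using hκ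
    simp [h0, h_one]
  · obtain ⟨i, hi⟩ : ∃ i, κ i ≠ 0 := by
      by_contra! hc
      exact hj0 (by simp [← hκ, hc])
    refine Finset.prod_eq_zero (Finset.mem_univ i) (h_mom i _ (Nat.one_le_iff_ne_zero.2 hi) ?_)
    exact ((Finset.single_le_sum (fun _ _ => Nat.zero_le _) (Finset.mem_univ i)).trans hκ.le).trans hj

lemma integrable_prod_mul_prod_pow {ι : Type*} [Fintype ι] {a : ι → ℝ → ℝ} {c : ι → ℝ}
    (ha : ∀ i, Integrable (a i)) (hs : ∀ i x, a i x ≠ 0 → |x| ≤ c i) (κ : ι → ℕ) :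
    Integrable (fun u : ι → ℝ => (∏ i, a i (u i)) * ∏ i, u i ^ κ i) := by
  simp_rw [← Finset.prod_mul_distrib]
  exact Integrable.fintype_prod fun i => integrable_mul_pow (ha i) (hs i) (κ i)

lemma prod_mul_taylorPoly {ι : Type*} [Fintype ι] [DecidableEq ι] (a : ι → ℝ → ℝ) (l : ℕ)
    (f : (ι → ℝ) → ℝ) (y u : ι → ℝ) :
    (∏ i, a i (u i)) * taylorPoly l f y (u + y) =
      ∑ j ∈ Finset.range (l + 1),
        ∑ κ ∈ (Finset.univ : Finset (ι → Fin (j + 1))).filter (fun κ => ∑ i, (κ i : ℕ) = j),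
          ((j.factorial : ℝ))⁻¹ * mderiv (fun i => (κ i : ℕ)) f y *
            ((∏ i, a i (u i)) * ∏ i, u i ^ (κ i : ℕ)) := by
  simp only [taylorPoly, Finset.mul_sum, Pi.add_apply, add_sub_cancel_right]
  refine Finset.sum_congr rfl fun j _ => Finset.sum_congr rfl fun κ _ => by ring

lemma integrable_prod_mul_taylorPoly {ι : Type*} [Fintype ι] [DecidableEq ι] {a : ι → ℝ → ℝ}
    {c : ι → ℝ} (ha : ∀ i, Integrable (a i)) (hs : ∀ i x, a i x ≠ 0 → |x| ≤ c i) (l : ℕ)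
    (f : (ι → ℝ) → ℝ) (y : ι → ℝ) :
    Integrable (fun u => (∏ i, a i (u i)) * taylorPoly l f y (u + y)) := by
  simp_rw [prod_mul_taylorPoly]
  exact integrable_finsetSum _ fun j _ => integrable_finsetSum _ fun κ _ =>
    (integrable_prod_mul_prod_pow ha hs _).const_mul _

lemma integral_prod_mul_taylorPoly {ι : Type*} [Fintype ι] [DecidableEq ι] {a : ι → ℝ → ℝ}
    {c : ι → ℝ} {ℓ l : ℕ} (ha : ∀ i, Integrable (a i)) (hs : ∀ i x, a i x ≠ 0 → |x| ≤ c i)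
    (h_one : ∀ i, ∫ x, a i x = 1)
    (h_mom : ∀ i, ∀ r : ℕ, 1 ≤ r → r ≤ ℓ → ∫ x, a i x * x ^ r = 0) (hl : l ≤ ℓ)
    (f : (ι → ℝ) → ℝ) (y : ι → ℝ) :
    ∫ u, (∏ i, a i (u i)) * taylorPoly l f y (u + y) = f y := by
  have hint := integrable_prod_mul_prod_pow ha hs
  simp_rw [prod_mul_taylorPoly]
  rw [integral_finsetSum _ fun j _ => integrable_finsetSum _ fun κ _ => (hint _).const_mul _]
  rw [Finset.sum_eq_single_of_mem 0 (by simp)]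
  · rw [integral_finsetSum _ fun κ _ => (hint _).const_mul _, Finset.sum_eq_single_of_mem 0]
    · rw [integral_const_mul,
        integral_prod_mul_prod_pow h_one h_mom (Nat.zero_le ℓ) (by simp),
        mderiv_zero (by simp)]
      simp
    · exact Finset.mem_filter.2 ⟨Finset.mem_univ _, by simp⟩
    · intro κ _ hκ
      exact absurd (funext fun i => Fin.ext (by simp)) hκ
  · intro j hj hj0
    rw [integral_finsetSum _ fun κ _ => (hint _).const_mul _]
    refine Finset.sum_eq_zero fun κ hκ => ?_
    rw [integral_const_mul, integral_prod_mul_prod_pow h_one h_mom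
      ((Finset.mem_range_succ_iff.1 hj).trans hl) (Finset.mem_filter.1 hκ).2, if_neg hj0, mul_zero]

lemma sqrt_sum_sq_rpow_le {ι : Type*} [Fintype ι] [Nonempty ι] {c u : ι → ℝ}
    (hc : ∀ i, 0 ≤ c i) (hu : ∀ i, |u i| ≤ c i) {β : ℝ} (hβ : 0 ≤ β) :
    Real.sqrt (∑ i, u i ^ 2) ^ β ≤ (Fintype.card ι : ℝ) ^ (β / 2) * ∑ i, c i ^ β := by
  obtain ⟨m, hm⟩ := Finite.exists_max c
  have h1 : ∑ i, u i ^ 2 ≤ Fintype.card ι * c m ^ 2 := by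
    rw [← nsmul_eq_mul]
    refine Finset.sum_le_card_nsmul _ _ _ fun i _ => ?_
    exact sq_le_sq' (by linarith [abs_le.1 ((hu i).trans (hm i))])
      (abs_le.1 ((hu i).trans (hm i))).2
  calc Real.sqrt (∑ i, u i ^ 2) ^ β ≤ Real.sqrt (Fintype.card ι * c m ^ 2) ^ β := by gcongr
    _ = (Fintype.card ι : ℝ) ^ (β / 2) * c m ^ β := by
        rw [Real.sqrt_mul (by positivity), Real.sqrt_sq (hc m),
          Real.mul_rpow (Real.sqrt_nonneg _) (hc m), Real.sqrt_eq_rpow,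
          ← Real.rpow_mul (by positivity)]
        ring_nf
    _ ≤ _ := by
        gcongr
        exact Finset.single_le_sum (f := fun i => c i ^ β)
          (fun i _ => Real.rpow_nonneg (hc i) β) (Finset.mem_univ m)

lemma HolderBall.integrable_prod_mul {ι κ : Type*} [Fintype ι] [Fintype κ] [DecidableEq ι]
    {a : κ → ℝ → ℝ} (ha : ∀ i, Integrable (a i)) {l : ℕ} {α L : ℝ} {f : (ι → ℝ) → ℝ}
    (hf : HolderBall l α L f) {p : (κ → ℝ) → ι → ℝ} (hp : Continuous p) :
    Integrable (fun u => (∏ i, a i (u i)) * f (p u)) :=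
  (Integrable.fintype_prod ha).mul_bdd (c := L)
    (hf.1.continuous.comp hp).aestronglyMeasurable
    (Filter.Eventually.of_forall fun u => hf.abs_le (p u))

/-- Bias of a product kernel with vanishing moments on a Hölder ball. -/
lemma HolderBall.abs_integral_prod_mul_sub_le {ι : Type*} [Fintype ι] [DecidableEq ι] [Nonempty ι]
    {a : ι → ℝ → ℝ} {c : ι → ℝ} {ℓ l : ℕ} {α L M : ℝ} {f : (ι → ℝ) → ℝ}
    (hf : HolderBall l α L f) (hα : 0 ≤ α) (hl : l ≤ ℓ)
    (ha : ∀ i, Integrable (a i)) (hc : ∀ i, 0 ≤ c i) (hs : ∀ i x, a i x ≠ 0 → |x| ≤ c i)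
    (h_one : ∀ i, ∫ x, a i x = 1)
    (h_mom : ∀ i, ∀ r : ℕ, 1 ≤ r → r ≤ ℓ → ∫ x, a i x * x ^ r = 0)
    (h_abs : ∀ i, ∫ x, |a i x| = M) (y : ι → ℝ) :
    |(∫ u, (∏ i, a i (u i)) * f (u + y)) - f y| ≤
      L * ((Fintype.card ι : ℝ) ^ (((l : ℝ) + α) / 2) * M ^ Fintype.card ι *
        ∑ i, c i ^ ((l : ℝ) + α)) := by
  have hL : 0 ≤ L := (abs_nonneg _).trans (hf.abs_le y)
  set B := (Fintype.card ι : ℝ) ^ (((l : ℝ) + α) / 2) * ∑ i, c i ^ ((l : ℝ) + α) with hB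
  have hint : Integrable (fun u : ι → ℝ => ∏ i, |a i (u i)|) :=
    Integrable.fintype_prod fun i => (ha i).abs
  rw [← integral_prod_mul_taylorPoly ha hs h_one h_mom hl f y, ← integral_sub (hf.integrable_prod_mul ha (by fun_prop))
    (integrable_prod_mul_taylorPoly ha hs l f y), ← Real.norm_eq_abs]
  calc ‖∫ u, ((∏ i, a i (u i)) * f (u + y) - (∏ i, a i (u i)) * taylorPoly l f y (u + y))‖
      ≤ ∫ u : ι → ℝ, (∏ i, |a i (u i)|) * (L * B) := by
        refine norm_integral_le_of_norm_le (hint.mul_const _)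
          (Filter.Eventually.of_forall fun u => ?_)
        rw [← mul_sub, norm_mul, Real.norm_eq_abs, Real.norm_eq_abs, Finset.abs_prod]
        by_cases h0 : ∀ i, a i (u i) ≠ 0
        · refine mul_le_mul_of_nonneg_left ((hf.2.2 (u + y) y).trans ?_) (by positivity)
          refine mul_le_mul_of_nonneg_left ?_ hL
          simp only [Pi.add_apply, add_sub_cancel_right]
          exact sqrt_sum_sq_rpow_le hc (fun i => hs i _ (h0 i)) (by positivity)
        · push Not at h0
          obtain ⟨i, hi⟩ := h0
          rw [Finset.prod_eq_zero (Finset.mem_univ i) (by simp [hi])]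
          simp
    _ = _ := by
        rw [integral_mul_const, integral_fintype_prod_volume_eq_prod (fun i x => |a i x|)]
        simp only [h_abs, Finset.prod_const, Finset.card_univ, hB]
        ring

/-- Coordinates outside a block integrate out of a product of probability weights. -/
lemma integral_prod_mul_comp_restrict {ι : Type*} [Fintype ι] {a : ι → ℝ → ℝ}
    (h_one : ∀ i, ∫ x, a i x = 1) (q : ι → Prop) [DecidablePred q] [inst : Fintype {i // q i}]
    (φ : ({i // q i} → ℝ) → ℝ) :
    ∫ u : ι → ℝ, (∏ i, a i (u i)) * φ (fun j => u j) =
      ∫ v : {i // q i} → ℝ, (∏ j : {i // q i}, a j (v j)) * φ v := by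
  obtain rfl : inst = Subtype.fintype q := Subsingleton.elim _ _
  have key := (volume_preserving_piEquivPiSubtypeProd (fun _ : ι => ℝ) q).integral_comp'
    (g := fun z : ({i // q i} → ℝ) × ({i // ¬ q i} → ℝ) =>
      ((∏ j : {i // q i}, a j (z.1 j)) * φ z.1) * ∏ j : {i // ¬ q i}, a j (z.2 j))
  rw [Measure.volume_eq_prod, integral_prod_mul (
        fun v : {i // q i} → ℝ => (∏ j : {i // q i}, a j (v j)) * φ v)
      (fun w : {i // ¬ q i} → ℝ => ∏ j : {i // ¬ q i}, a j (w j)),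
    integral_fintype_prod_volume_eq_prod (fun j : {i // ¬ q i} => a j.1)] at key
  simp only [h_one, Finset.prod_const_one, mul_one] at key
  rw [← key]
  refine integral_congr_ae (Filter.Eventually.of_forall fun u => ?_)
  dsimp only
  rw [← Fintype.prod_subtype_mul_prod_subtype q (fun i => a i (u i))]
  simp only [MeasurableEquiv.piEquivPiSubtypeProd, MeasurableEquiv.coe_mk,
    Equiv.piEquivPiSubtypeProd_apply]
  ring

lemma integral_abs_det_mul_comp_mulVec_sub {ι : Type*} [Fintype ι] [DecidableEq ι]
    {M : Matrix ι ι ℝ} (hM : M.det ≠ 0) (x : ι → ℝ) (Φ : (ι → ℝ) → ℝ) :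
    ∫ t, |M.det| * Φ (M.mulVec (t - x)) = ∫ s, Φ s := by
  rw [integral_sub_right_eq_self (fun t => |M.det| * Φ (M.mulVec t)) x, integral_const_mul]
  have hemb : MeasurableEmbedding (Matrix.toLin' M) :=
    (LinearMap.continuous_of_finiteDimensional (Matrix.toLin' M)).measurableEmbedding
      (Matrix.mulVec_injective_of_isUnit ((Matrix.isUnit_iff_isUnit_det M).2 hM.isUnit))
  have h1 := hemb.integral_map (μ := volume) Φ
  rw [Real.map_matrix_volume_pi_eq_smul_volume_pi hM, integral_smul_measure] at h1
  simp only [Matrix.toLin'_apply] at h1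
  rw [← h1, ENNReal.toReal_ofReal (abs_nonneg _), smul_eq_mul, abs_inv,
    mul_inv_cancel_left₀ (abs_ne_zero.2 hM)]

lemma Gblock_eq_prod_rescale {d : ℕ} (g : ℝ → ℝ) (I : Finset (Fin d)) (h t : Fin d → ℝ) :
    Gblock g I h t = ∏ j, rescale g (if j ∈ I then h j else 1) (t j) := by
  rw [Gblock, ← Finset.prod_mul_prod_compl I]
  congr 1
  · exact Finset.prod_congr rfl fun j hj => by simp [rescale, hj]
  · exact Finset.prod_congr rfl fun j hj => by simp [rescale, Finset.mem_compl.1 hj]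

lemma G0_eq_prod_rescale {d : ℕ} (g : ℝ → ℝ) (t : Fin d → ℝ) :
    G0 g t = ∏ j, rescale g 1 (t j) := by
  simp [G0, rescale]

/-- **Lemma 4 (bias bound in the additive multi-index model).** If
`F(t) = Σ_i f_i(E_iᵀ t)` with `f_i ∈ ℍ_{|I_i|}(β_i, L)`, `β_i = l_i + α_i`, `l_i ≤ ℓ`, and
`g` has `ℓ` vanishing moments, then for every `x`,
`|∫ K_{(I,E,h)}(t−x)F(t)dt − F(x)| ≤ L Σ_i |I_i|^{β_i/2} ‖g‖₁^{|I_i|} Σ_{j∈I_i} h_j^{β_i}`. -/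
theorem addKernel_bias_bound
    (d k ℓ : ℕ) (hd : 1 ≤ d)
    (g : ℝ → ℝ) (hg_int : Integrable g)
    (hg_supp : Function.support g ⊆ Set.Icc (-(1/2) : ℝ) (1/2))
    (hg_one : (∫ x, g x) = 1)
    (hg_mom : ∀ r : ℕ, 1 ≤ r → r ≤ ℓ → (∫ x, g x * x ^ r) = 0)
    (I : Fin k → Finset (Fin d)) (hI : IsPartition I)
    (E : Matrix (Fin d) (Fin d) ℝ) (hE : E.det ≠ 0)
    (h : Fin d → ℝ) (hh : ∀ j, 0 < h j)
    (l : Fin k → ℕ) (α : Fin k → ℝ) (L : ℝ)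
    (hα : ∀ i, 0 < α i ∧ α i ≤ 1) (hl : ∀ i, l i ≤ ℓ)
    (f : (i : Fin k) → (↥(I i) → ℝ) → ℝ)
    (hf : ∀ i, HolderBall (l i) (α i) L (f i))
    (F : (Fin d → ℝ) → ℝ)
    (hF : ∀ t, F t = ∑ i, f i (fun j => ∑ m, E m j.1 * t m)) :
    ∀ x : Fin d → ℝ,
      |(∫ t, addKernel g I E h (t - x) * F t) - F x|
        ≤ L * ∑ i, ((I i).card : ℝ) ^ (((l i : ℝ) + α i) / 2) *
            (∫ y, |g y|) ^ (I i).card *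
            ∑ j ∈ I i, h j ^ ((l i : ℝ) + α i) := by
  intro x
  have hw : ∀ i j, 0 < (if j ∈ I i then h j else 1) := fun i j => by
    split_ifs
    exacts [hh j, one_pos]
  have h_one : ∀ {c : ℝ}, 0 < c → ∫ u, rescale g c u = 1 := fun hc => by
    rw [integral_rescale g hc, hg_one]
  have h_int : ∀ {c : ℝ}, 0 < c → Integrable (rescale g c) := fun hc =>
    integrable_rescale hg_int hc.ne'
  set y := E.transpose.mulVec x with hy
  set p : (i : Fin k) → (Fin d → ℝ) → ↥(I i) → ℝ := fun i s j => s j + y j with hp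
  have hpc : ∀ i, Continuous (p i) := fun i => by fun_prop
  have hFt : ∀ t, F t = ∑ i, f i (p i (E.transpose.mulVec (t - x))) := fun t => by
    rw [hF]
    refine Finset.sum_congr rfl fun i _ => congrArg (f i) (funext fun j => ?_)
    simp only [hp, hy, Matrix.mulVec_sub, Pi.sub_apply, sub_add_cancel]
    simp [Matrix.mulVec, dotProduct]
  have hFx : F x = ∑ i, f i (fun j => y j) := by
    rw [hFt]
    simp [hp]
  have hG : ∀ i m, Integrable (fun s => Gblock g (I m) h s * f i (p i s)) := fun i m => by
    simp_rw [Gblock_eq_prod_rescale]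
    exact (hf i).integrable_prod_mul (fun j => h_int (hw m j)) (hpc i)
  have hG0 : ∀ i, Integrable (fun s => G0 g s * f i (p i s)) := fun i => by
    simp_rw [G0_eq_prod_rescale]
    exact (hf i).integrable_prod_mul (fun j => h_int one_pos) (hpc i)
  have h_off : ∀ i m, m ≠ i →
      ∫ s, Gblock g (I m) h s * f i (p i s) = ∫ s, G0 g s * f i (p i s) := fun i m hmi => by
    simp_rw [Gblock_eq_prod_rescale, G0_eq_prod_rescale]
    rw [integral_prod_mul_comp_restrict (fun j => h_one (hw m j)) (· ∈ I i)
        (fun v => f i (fun j => v j + y j)),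
      integral_prod_mul_comp_restrict (fun _ => h_one one_pos) (· ∈ I i)
        (fun v => f i (fun j => v j + y j))]
    have hnot : ∀ j : ↥(I i), j.1 ∉ I m := fun j hj =>
      Finset.disjoint_left.1 (hI.2.1 m i hmi) hj j.2
    simp [hnot]
  have h_diag : ∀ i, ∫ s, Gblock g (I i) h s * f i (p i s) =
      ∫ v : ↥(I i) → ℝ, (∏ j : ↥(I i), rescale g (h j) (v j)) * f i (v + fun j : ↥(I i) => y j) :=
    fun i => by
    simp_rw [Gblock_eq_prod_rescale]
    rw [integral_prod_mul_comp_restrict (fun j => h_one (hw i j)) (· ∈ I i)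
        (fun v => f i (fun j => v j + y j))]
    simp [Pi.add_def]
  have h_main : ∫ t, addKernel g I E h (t - x) * F t =
      ∑ i, ∫ s, Gblock g (I i) h s * f i (p i s) := by
    have hdet : E.transpose.det ≠ 0 := by rwa [Matrix.det_transpose]
    have hcv := integral_abs_det_mul_comp_mulVec_sub hdet x (fun s =>
      ∑ i, ((∑ m, Gblock g (I m) h s * f i (p i s)) - ((k : ℝ) - 1) * (G0 g s * f i (p i s))))
    have hsum : ∀ i, Integrable (fun s => ∑ m, Gblock g (I m) h s * f i (p i s)) := fun i =>
      integrable_finsetSum _ fun m _ => hG i m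
    calc ∫ t, addKernel g I E h (t - x) * F t = _ := by
          refine Eq.trans (integral_congr_ae (Filter.Eventually.of_forall fun t => ?_)) hcv
          simp only [addKernel, hFt, Matrix.det_transpose, Finset.sum_sub_distrib,
            ← Finset.mul_sum, ← Finset.sum_mul]
          ring
      _ = ∑ i, ((∑ m, ∫ s, Gblock g (I m) h s * f i (p i s)) -
            ((k : ℝ) - 1) * ∫ s, G0 g s * f i (p i s)) := by
          rw [integral_finsetSum _ fun i _ => Integrable.sub' (hsum i) ((hG0 i).const_mul _)]
          refine Finset.sum_congr rfl fun i _ => ?_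
          rw [integral_sub (hsum i) ((hG0 i).const_mul _), integral_const_mul,
            integral_finsetSum _ fun m _ => hG i m]
      _ = _ := by
          refine Finset.sum_congr rfl fun i _ => ?_
          rw [← Finset.add_sum_erase _ _ (Finset.mem_univ i),
            Finset.sum_congr rfl fun m hm => h_off i m (Finset.ne_of_mem_erase hm),
            Finset.sum_const, Finset.card_erase_of_mem (Finset.mem_univ i), Finset.card_univ,
            Fintype.card_fin, nsmul_eq_mul, Nat.cast_pred i.pos]
          ring
  rw [h_main, hFx, ← Finset.sum_sub_distrib, Finset.mul_sum]
  refine (Finset.abs_sum_le_sum_abs _ _).trans (Finset.sum_le_sum fun i _ => ?_)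
  have : Nonempty ↥(I i) := (hI.1 i).to_subtype
  have hbias := (hf i).abs_integral_prod_mul_sub_le (a := fun j : ↥(I i) => rescale g (h j))
    (c := fun j : ↥(I i) => h j) (hα i).1.le (hl i) (fun j => h_int (hh j)) (fun j => (hh j).le)
    (fun j u hu => abs_le_of_rescale_ne_zero hg_supp (hh j) hu) (fun j => h_one (hh j))
    (fun j r hr hrl => by rw [integral_rescale_mul_pow g (hh j), hg_mom r hr hrl, mul_zero])
    (fun j => integral_abs_rescale g (hh j)) (fun j => y j)
  rw [h_diag i]
  rwa [Fintype.card_coe, Finset.sum_coe_sort (I i) (fun j => h j ^ ((l i : ℝ) + α i))] at hbias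

end
end
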